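/- Let (V,H) be a p+q almost-product structure on an n-dimensional (pseudo-)Riemannian manifold (n = p+q), with projectors v and h = g − v, and let α be a function. The traceless symmetric 2-tensor P = α (q v − p h) is a conformal tensor if, and only if: (i) the eigenstructure (V,H) is umbilical, i.e. the second fundamental forms can be written S_v = (1/2) v ⊗ a and S_h = (1/2) h ⊗ b; and (ii) the traces Tr S_v = (p/2) a and Tr S_h = (q/2) b and the scalar α are related by a + b = − d ln|α|. -/

import Mathlib

/- An algebraic model of the differential geometry of an n-dimensional
(pseudo-)Riemannian manifold: `F` models the ring of smooth real functions,
`X` the `F`-module of vector fields, `act` the action of vector fields on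
functions by derivation, `bracket` the Lie bracket, `g` the metric, `conn`
the Levi-Civita connection and `e`, `eps` a (pseudo-)orthonormal frame
recording the dimension and the signature. -/

noncomputable section

namespace KCT

/-- complex multiplication on pairs of functions -/
def cxMul {F : Type} [CommRing F] (a b : F × F) : F × F :=
  (a.1 * b.1 - a.2 * b.2, a.1 * b.2 + a.2 * b.1)

/-- the imaginary unit -/
def cxI {F : Type} [CommRing F] : F × F := (0, 1)

/-- complex conjugation -/
def cxConj {F : Type} [CommRing F] (a : F × F) : F × F := (a.1, -a.2)

def cxSmul {F : Type} [CommRing F] (f : F) (a : F × F) : F × F := (f * a.1, f * a.2)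

/-- complex inverse (meaningful when the squared modulus is invertible) -/
def cxInv {F : Type} [CommRing F] (a : F × F) : F × F :=
  cxSmul (Ring.inverse (a.1 * a.1 + a.2 * a.2)) (cxConj a)

/-- The underlying (local) smooth manifold: smooth functions `F`,
vector fields `X`, derivations and Lie bracket. -/
structure Man where
  F : Type
  [instCRF : CommRing F]
  [instAlg : Algebra ℝ F]
  X : Type
  [instACG : AddCommGroup X]
  [instMod : Module F X]
  act : X → F → F
  bracket : X → X → X
  act_addf : ∀ x f₁ f₂, act x (f₁ + f₂) = act x f₁ + act x f₂
  act_mulf : ∀ x f₁ f₂, act x (f₁ * f₂) = act x f₁ * f₂ + f₁ * act x f₂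
  act_addv : ∀ x y f, act (x + y) f = act x f + act y f
  act_smulv : ∀ (h : F) x f, act (h • x) f = h * act x f
  act_const : ∀ x r, act x (algebraMap ℝ F r) = 0
  /-- pointwise positivity of a function -/
  Pos : F → Prop
  pos_one : Pos 1
  pos_mul : ∀ f h, Pos f → Pos h → Pos (f * h)
  pos_unit : ∀ f, Pos f → IsUnit f
  sq_pos : ∀ f, IsUnit f → Pos (f * f)
  /-- the exponential of a function -/
  fexp : F → F
  fexp_unit : ∀ f, IsUnit (fexp f)
  fexp_deriv : ∀ x f, act x (fexp f) = fexp f * act x f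
  /-- locally, closed one-forms are exact -/
  closed_exact : ∀ ω : X → F, (∀ (f : F) x, ω (f • x) = f * ω x) →
    (∀ x y, ω (x + y) = ω x + ω y) →
    (∀ x y, act x (ω y) - act y (ω x) - ω (bracket x y) = 0) →
    ∃ f : F, ∀ x, ω x = act x f

attribute [instance] Man.instCRF Man.instAlg Man.instACG Man.instMod

/-- extension of the derivation action to complex valued functions -/
def Man.cxAct (M : Man) (x : M.X) (f : M.F × M.F) : M.F × M.F := (M.act x f.1, M.act x f.2)

/-- An `n`-dimensional (pseudo-)Riemannian metric on `M` together with its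
Levi-Civita connection and a (pseudo-)orthonormal frame. -/
structure Metric (M : Man) (n : ℕ) where
  g : M.X → M.X → M.F
  conn : M.X → M.X → M.X
  e : Fin n → M.X
  eps : Fin n → M.F
  g_symm : ∀ x y, g x y = g y x
  g_addl : ∀ x y z, g (x + y) z = g x z + g y z
  g_smull : ∀ (f : M.F) x y, g (f • x) y = f * g x y
  conn_addl : ∀ x y z, conn (x + y) z = conn x z + conn y z
  conn_smull : ∀ (f : M.F) x y, conn (f • x) y = f • conn x y
  conn_addr : ∀ x y z, conn x (y + z) = conn x y + conn x z
  conn_leibniz : ∀ x (f : M.F) y, conn x (f • y) = M.act x f • y + f • conn x y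
  torsion_free : ∀ x y, conn x y - conn y x = M.bracket x y
  metric_compat : ∀ x y z, M.act x (g y z) = g (conn x y) z + g y (conn x z)
  frame_on : ∀ i j, g (e i) (e j) = if i = j then eps i else 0
  eps_pm : ∀ i, eps i = 1 ∨ eps i = -1
  frame_complete : ∀ x, x = ∑ i, (eps i * g x (e i)) • e i

namespace Metric

variable {M : Man} {n : ℕ} (G : Metric M n)

/-- `{x,y} = ∇ₓ y + ∇_y x` -/
def sb (x y : M.X) : M.X := G.conn x y + G.conn y x

/-- covariant derivative of a 2-tensor -/
def nabla2 (T : M.X → M.X → M.F) (x y z : M.X) : M.F :=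
  M.act x (T y z) - T (G.conn x y) z - T y (G.conn x z)

/-- total symmetrization `∇_(a T_bc)` (cyclic sum) -/
def killingOp (T : M.X → M.X → M.F) (x y z : M.X) : M.F :=
  G.nabla2 T x y z + G.nabla2 T y z x + G.nabla2 T z x y

def Bilin (_G : Metric M n) (T : M.X → M.X → M.F) : Prop :=
  (∀ (f : M.F) x y, T (f • x) y = f * T x y) ∧ (∀ x y z, T (x + y) z = T x z + T y z) ∧
    (∀ (f : M.F) x y, T x (f • y) = f * T x y) ∧ (∀ x y z, T x (y + z) = T x y + T x z)

def Symm2 (_G : Metric M n) (T : M.X → M.X → M.F) : Prop := ∀ x y, T x y = T y x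

/-- second order Killing tensor: `∇_(a K_bc) = 0` -/
def IsKilling (T : M.X → M.X → M.F) : Prop :=
  G.Bilin T ∧ G.Symm2 T ∧ ∀ x y z, G.killingOp T x y z = 0

/-- the total symmetrization `S{g ⊗ t}` -/
def symG (t : M.X → M.F) (x y z : M.X) : M.F :=
  G.g x y * t z + G.g y z * t x + G.g z x * t y

/-- metric trace of a 2-tensor -/
def tr2 (T : M.X → M.X → M.F) : M.F := ∑ i, G.eps i * T (G.e i) (G.e i)

/-- divergence `(∇·T)_c = ∇^a T_ac` -/
def div2 (T : M.X → M.X → M.F) (z : M.X) : M.F :=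
  ∑ i, G.eps i * G.nabla2 T (G.e i) (G.e i) z

/-- the canonical 1-form `t = (2/(n+2)) ∇·T` of the conformal equation -/
def ct (T : M.X → M.X → M.F) (z : M.X) : M.F :=
  algebraMap ℝ M.F (2 / ((n : ℝ) + 2)) * G.div2 T z

/-- conformal equation with a prescribed 1-form `t` -/
def IsConformalWith (T : M.X → M.X → M.F) (t : M.X → M.F) : Prop :=
  G.Bilin T ∧ G.Symm2 T ∧ ∀ x y z, G.killingOp T x y z = G.symG t x y z

/-- second order conformal tensor: `∇_(a T_bc) = S{g ⊗ t}`, `t = (2/(n+2)) ∇·T` -/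
def IsConformal (T : M.X → M.X → M.F) : Prop := G.IsConformalWith T (G.ct T)

/-- the 1-form associated to a vector field -/
def flat (x z : M.X) : M.F := G.g x z

/-- exterior derivative of a 1-form -/
def d1 (_G : Metric M n) (ω : M.X → M.F) (x y : M.X) : M.F :=
  M.act x (ω y) - M.act y (ω x) - ω (M.bracket x y)

def Closed1 (ω : M.X → M.F) : Prop := ∀ x y, G.d1 ω x y = 0

/-- gradient vector field of a function -/
def grad (f : M.F) : M.X := ∑ i, (G.eps i * M.act (G.e i) f) • G.e i

/-- vector field associated to a 1-form -/
def sharp (ω : M.X → M.F) : M.X := ∑ i, (G.eps i * ω (G.e i)) • G.e i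

/-- `x` is an eigenvector field of `T` with eigenvalue function `ρ` -/
def IsEigen (T : M.X → M.X → M.F) (ρ : M.F) (x : M.X) : Prop := ∀ z, T x z = ρ * G.g x z

/-- orthogonal projector onto a (regular) distribution -/
def IsProjector (v : M.X → M.X) : Prop :=
  (∀ (f : M.F) x, v (f • x) = f • v x) ∧ (∀ x y, v (x + y) = v x + v y) ∧
    (∀ x, v (v x) = v x) ∧ (∀ x y, G.g (v x) y = G.g x (v y))

/-- trace of a projector (= dimension of the distribution) -/
def ptrace (v : M.X → M.X) : M.F := ∑ i, G.eps i * G.g (v (G.e i)) (G.e i)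

/-- the complementary (orthogonal) projector -/
def co (_G : Metric M n) (v : M.X → M.X) (x : M.X) : M.X := x - v x

/-- generalized second fundamental form `Q_v(x,y) = h(∇_{v(x)} v(y))` -/
def Qv (v : M.X → M.X) (x y : M.X) : M.X := G.co v (G.conn (v x) (v y))

/-- umbilical distribution with `S_v = ½ v ⊗ a` -/
def UmbilicalWith (v : M.X → M.X) (a : M.X) : Prop :=
  ∀ x y, G.Qv v x y + G.Qv v y x = G.g (v x) (v y) • a

/-- umbilical distribution of dimension `p` : `S_v = (1/p) v ⊗ Tr S_v` -/
def Umbilical (v : M.X → M.X) (p : ℕ) : Prop :=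
  ∀ x y, (p : M.F) • (G.Qv v x y + G.Qv v y x)
    = (2 * G.g (v x) (v y)) • ∑ i, G.eps i • G.Qv v (G.e i) (G.e i)

/-- (totally) geodesic distribution: `S_v = 0` -/
def Geodesic (v : M.X → M.X) : Prop := ∀ x y, G.Qv v x y + G.Qv v y x = 0

/-- the symmetric 2-tensor `α v + β h` of an almost-product structure -/
def apTensor (v : M.X → M.X) (α β : M.F) (x y : M.X) : M.F :=
  α * G.g (v x) y + β * G.g (x - v x) y

/-- projector on the line spanned by the unitary (`g(u,u) = ε = ±1`) field `u` -/
def uproj (u : M.X) (ε : M.F) (x : M.X) : M.X := (ε * G.g u x) • u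

/-- acceleration `u̇ = ∇_u u` -/
def acc (u : M.X) : M.X := G.conn u u

/-- expansion `θ = ∇·u` -/
def expan (u : M.X) : M.F := ∑ i, G.eps i * G.g (G.conn (G.e i) u) (G.e i)

/-- vanishing of the shear `σ` of a unitary vector field `u` -/
def ShearFree (u : M.X) (ε : M.F) : Prop := ∀ x y,
  G.g (G.conn (G.co (G.uproj u ε) x) u) (G.co (G.uproj u ε) y)
      + G.g (G.conn (G.co (G.uproj u ε) y) u) (G.co (G.uproj u ε) x)
    = algebraMap ℝ M.F (2 / ((n : ℝ) - 1)) * G.expan u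
        * G.g (G.co (G.uproj u ε) x) (G.co (G.uproj u ε) y)

/-- condition (i) of Proposition 1: on each eigenspace,
`(T - ρ g){x,y} = g(x,y)(dρ - t)` -/
def CondI (T : M.X → M.X → M.F) (t : M.X → M.F) : Prop :=
  ∀ (ρ : M.F) (x y : M.X), G.IsEigen T ρ x → G.IsEigen T ρ y → ∀ z,
    T (G.sb x y) z - ρ * G.g (G.sb x y) z = G.g x y * (M.act z ρ - t z)

/-- condition (ii) of Proposition 1 (condition (iii) of Theorem 1):
for eigenvectors with pairwise different eigenvalues,
`T(x,{y,z}) + T(z,{x,y}) + T(y,{z,x}) = 0` -/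
def CondIII (T : M.X → M.X → M.F) : Prop :=
  ∀ (ρ₁ ρ₂ ρ₃ : M.F) (x y z : M.X),
    G.IsEigen T ρ₁ x → G.IsEigen T ρ₂ y → G.IsEigen T ρ₃ z →
    IsUnit (ρ₁ - ρ₂) → IsUnit (ρ₂ - ρ₃) → IsUnit (ρ₁ - ρ₃) →
    T x (G.sb y z) + T z (G.sb x y) + T y (G.sb z x) = 0

/- Curvature -/

def curv (x y z : M.X) : M.X :=
  G.conn x (G.conn y z) - G.conn y (G.conn x z) - G.conn (M.bracket x y) z

def riem (x y z w : M.X) : M.F := G.g (G.curv x y z) w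

def ricci (x y : M.X) : M.F := ∑ i, G.eps i * G.riem (G.e i) x y (G.e i)

def scal : M.F := ∑ i, G.eps i * G.ricci (G.e i) (G.e i)

/-- covariant derivative of a 4-tensor -/
def nabla4 (T : M.X → M.X → M.X → M.X → M.F) (x a b c d : M.X) : M.F :=
  M.act x (T a b c d) - T (G.conn x a) b c d - T a (G.conn x b) c d
    - T a b (G.conn x c) d - T a b c (G.conn x d)

/- Dimension four: Hodge duality, self-dual formalism, Weyl tensor -/

/-- composition (`Tr₂₃`-contraction) of two 2-tensors -/
def comp2 (A B : M.X → M.X → M.F) (x y : M.X) : M.F :=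
  ∑ i, G.eps i * A x (G.e i) * B (G.e i) y

end Metric

namespace Metric

variable {M : Man} (G : Metric M 4)

/-- the metric volume element `η` -/
def vol (x0 x1 x2 x3 : M.X) : M.F :=
  ((Matrix.of fun i j => G.eps j * G.g (![x0, x1, x2, x3] i) (G.e j)) :
    Matrix (Fin 4) (Fin 4) M.F).det

/-- Hodge dual of a 2-form -/
def hodge (U : M.X → M.X → M.F) (x y : M.X) : M.F :=
  algebraMap ℝ M.F (1 / 2) *
    ∑ i, ∑ j, G.eps i * G.eps j * G.vol x y (G.e i) (G.e j) * U (G.e i) (G.e j)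

/-- exterior codifferential of a 2-form -/
def codiff2 (U : M.X → M.X → M.F) (z : M.X) : M.F :=
  -∑ i, G.eps i * G.nabla2 U (G.e i) (G.e i) z

/-- the 1-form `i(δU)U` -/
def iD (U : M.X → M.X → M.F) (z : M.X) : M.F := U (G.sharp (G.codiff2 U)) z

/-- `Φ[U] = i(δU)U - i(δ*U)*U` -/
def Phi (U : M.X → M.X → M.F) (z : M.X) : M.F := G.iD U z - G.iD (G.hodge U) z

/-- the self-dual unitary 2-form `𝒰 = (1/√2)(U - i *U)` -/
def sdU (U : M.X → M.X → M.F) (x y : M.X) : M.F × M.F :=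
  (algebraMap ℝ M.F (Real.sqrt 2)⁻¹ * U x y,
    -(algebraMap ℝ M.F (Real.sqrt 2)⁻¹ * G.hodge U x y))

/-- the self-dual metric `𝒢 = ½(G - i η)` -/
def sdG (a b c d : M.X) : M.F × M.F :=
  (algebraMap ℝ M.F (1 / 2) * (G.g a c * G.g b d - G.g a d * G.g b c),
    -(algebraMap ℝ M.F (1 / 2) * G.vol a b c d))

/-- covariant derivative of a complex 2-tensor -/
def nabla2C (T : M.X → M.X → M.F × M.F) (x y z : M.X) : M.F × M.F :=
  M.cxAct x (T y z) - T (G.conn x y) z - T y (G.conn x z)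

/-- codifferential of a complex 2-form -/
def codiff2C (T : M.X → M.X → M.F × M.F) (z : M.X) : M.F × M.F :=
  -∑ i, cxSmul (G.eps i) (G.nabla2C T (G.e i) (G.e i) z)

/-- the (complex) vector field associated with a complex 1-form -/
def sharpC (ω : M.X → M.F × M.F) : M.X × M.X :=
  (G.sharp fun z => (ω z).1, G.sharp fun z => (ω z).2)

/-- evaluation of a complex 2-form on a complex vector (first slot) -/
def evalC (_G : Metric M 4) (T : M.X → M.X → M.F × M.F) (ξ : M.X × M.X) (z : M.X) : M.F × M.F :=
  T ξ.1 z + cxMul cxI (T ξ.2 z)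

/-- interior product of a complex vector with a complex 4-tensor (first slot) -/
def evalC4 (_G : Metric M 4) (A : M.X → M.X → M.X → M.X → M.F × M.F) (ξ : M.X × M.X) (x y z : M.X) :
    M.F × M.F :=
  A ξ.1 x y z + cxMul cxI (A ξ.2 x y z)

/-- `Σ[U] ≡ ∇𝒰 - i(δ𝒰)𝒰 ⊗ 𝒰 - i(δ𝒰)𝒢 = 0` (the umbilical condition) -/
def SigmaCond (U : M.X → M.X → M.F) : Prop :=
  ∀ x y z, G.nabla2C (G.sdU U) x y z
    = cxMul (G.evalC (G.sdU U) (G.sharpC (G.codiff2C (G.sdU U))) x) (G.sdU U y z)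
        + G.evalC4 G.sdG (G.sharpC (G.codiff2C (G.sdU U))) x y z

/-- the Weyl tensor (dimension four) -/
def weyl (a b c d : M.X) : M.F :=
  G.riem a b c d
    - algebraMap ℝ M.F (1 / 2) * (G.g a c * G.ricci b d + G.g b d * G.ricci a c
        - G.g a d * G.ricci b c - G.g b c * G.ricci a d)
    + algebraMap ℝ M.F (1 / 6) * G.scal * (G.g a c * G.g b d - G.g a d * G.g b c)

/-- Hodge dual of a double 2-form on its first pair of indices -/
def hodgeL (T : M.X → M.X → M.X → M.X → M.F) (a b c d : M.X) : M.F :=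
  algebraMap ℝ M.F (1 / 2) *
    ∑ i, ∑ j, G.eps i * G.eps j * G.vol a b (G.e i) (G.e j) * T (G.e i) (G.e j) c d

/-- the self-dual Weyl tensor `𝒲 = ½(W - i *W)` -/
def cWeyl (a b c d : M.X) : M.F × M.F :=
  (algebraMap ℝ M.F (1 / 2) * G.weyl a b c d,
    -(algebraMap ℝ M.F (1 / 2) * G.hodgeL G.weyl a b c d))

/-- composition of complex double 2-forms (as endomorphisms of bivectors) -/
def compW (A B : M.X → M.X → M.X → M.X → M.F × M.F) (a b c d : M.X) : M.F × M.F :=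
  cxSmul (algebraMap ℝ M.F (1 / 2))
    (∑ i, ∑ j, cxSmul (G.eps i * G.eps j)
      (cxMul (A a b (G.e i) (G.e j)) (B (G.e i) (G.e j) c d)))

/-- trace of a complex double 2-form (as an endomorphism of bivectors) -/
def trW (A : M.X → M.X → M.X → M.X → M.F × M.F) : M.F × M.F :=
  cxSmul (algebraMap ℝ M.F (1 / 2))
    (∑ i, ∑ j, cxSmul (G.eps i * G.eps j) (A (G.e i) (G.e j) (G.e i) (G.e j)))

/-- the double Weyl eigenvalue `ρ = -Tr 𝒲³ / Tr 𝒲²` -/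
def rhoWeyl : M.F × M.F :=
  -(cxMul (cxInv (G.trW (G.compW G.cWeyl G.cWeyl)))
      (G.trW (G.compW (G.compW G.cWeyl G.cWeyl) G.cWeyl)))

/-- the concomitant `𝒮 = (1/(3ρ))(𝒲 - ρ 𝒢)` -/
def sWeyl (a b c d : M.X) : M.F × M.F :=
  cxMul (cxInv (cxSmul 3 G.rhoWeyl)) (G.cWeyl a b c d - cxMul G.rhoWeyl (G.sdG a b c d))

/-- divergence-free Weyl tensor (vanishing Cotton tensor): `δW = 0` -/
def DivFreeWeyl : Prop :=
  ∀ b c d, ∑ i, G.eps i * G.nabla4 G.weyl (G.e i) (G.e i) b c d = 0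

/-- the bivector image `A(X)` of a bivector by a double 2-form -/
def sContract (A : M.X → M.X → M.X → M.X → M.F × M.F) (Xb : M.X → M.X → M.F × M.F)
    (x y : M.X) : M.F × M.F :=
  cxSmul (algebraMap ℝ M.F (1 / 2))
    (∑ i, ∑ j, cxSmul (G.eps i * G.eps j)
      (cxMul (A x y (G.e i) (G.e j)) (Xb (G.e i) (G.e j))))

/-- the scalar `A(X,X)` -/
def sNorm (A : M.X → M.X → M.X → M.X → M.F × M.F) (Xb : M.X → M.X → M.F × M.F) :
    M.F × M.F :=
  cxSmul (algebraMap ℝ M.F (1 / 2))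
    (∑ i, ∑ j, cxSmul (G.eps i * G.eps j)
      (cxMul (G.sContract A Xb (G.e i) (G.e j)) (Xb (G.e i) (G.e j))))

/-- self-dual complex bivector: `*𝒳 = i 𝒳` -/
def SelfDualC (Xb : M.X → M.X → M.F × M.F) : Prop :=
  ∀ x y, ((G.hodge fun a b => (Xb a b).1) x y, (G.hodge fun a b => (Xb a b).2) x y)
    = cxMul cxI (Xb x y)

/-- Lorentzian signature (-+++) -/
def Lorentz : Prop := G.eps 0 = -1 ∧ G.eps 1 = 1 ∧ G.eps 2 = 1 ∧ G.eps 3 = 1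

end Metric


theorem eq_zero_of_idempotent_of_trace_eq_zero {ι R : Type*} [Fintype ι] [DecidableEq ι]
    [CommRing R] [Algebra ℝ R] (A : Matrix ι ι R) (hA : A * A = A) (ht : A.trace = 0) :
    A = 0 := by
  have key : IsUnit (1 - A).det := by
    by_contra hu
    obtain ⟨I, hI, hmem⟩ := exists_max_ideal_of_mem_nonunits hu
    let _ := Ideal.Quotient.field I
    let φ := Ideal.Quotient.mk I
    have : CharZero (R ⧸ I) :=
      charZero_of_injective_ringHom (φ.comp (algebraMap ℝ R)).injective
    have hB : IsIdempotentElem (Matrix.toLin' (A.map φ)) := by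
      rw [IsIdempotentElem, Module.End.mul_eq_comp, ← Matrix.toLin'_mul, ← Matrix.map_mul, hA]
    have htr : (A.map φ).trace = φ A.trace := by simp [Matrix.trace]
    have h0 := (LinearMap.IsIdempotentElem.trace_eq_zero_iff hB).1 (by
      rw [Matrix.trace_toLin'_eq, htr, ht, map_zero])
    have h1 : A.map φ = 0 := by simpa using h0
    have h2 : φ (1 - A).det = 0 := Ideal.Quotient.eq_zero_iff_mem.2 hmem
    rw [RingHom.map_det, map_sub, map_one, RingHom.mapMatrix_apply, h1] at h2
    simp at h2
  have h1 : A * (1 - A) = 0 := by rw [mul_sub, mul_one, hA, sub_self]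
  have h2 : IsUnit (1 - A) := (Matrix.isUnit_iff_isUnit_det _).2 key
  exact (h2.mul_left_eq_zero).1 h1

namespace Man

variable {M : Man}

theorem isUnit_natCast (k : ℕ) (hk : k ≠ 0) : IsUnit (k : M.F) := by
  have h : IsUnit (k : ℝ) := (Nat.cast_ne_zero.2 hk).isUnit
  simpa using h.map (algebraMap ℝ M.F)

theorem act_natCast (x : M.X) (k : ℕ) : M.act x (k : M.F) = 0 := by
  simpa using M.act_const x k

theorem act_zero (x : M.X) : M.act x 0 = 0 := by
  simpa using act_natCast x 0

theorem act_neg (x : M.X) (f : M.F) : M.act x (-f) = -M.act x f := by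
  have h := M.act_addf x f (-f)
  rw [add_neg_cancel, act_zero] at h
  linear_combination -h

theorem act_sub (x : M.X) (f k : M.F) : M.act x (f - k) = M.act x f - M.act x k := by
  rw [sub_eq_add_neg, act_addf, act_neg, sub_eq_add_neg]

theorem act_one (x : M.X) : M.act x 1 = 0 := by
  simpa using act_natCast x 1

theorem act_sum (x : M.X) {ι : Type*} (s : Finset ι) (f : ι → M.F) :
    M.act x (∑ i ∈ s, f i) = ∑ i ∈ s, M.act x (f i) :=
  map_sum (AddMonoidHom.mk' (M.act x) (M.act_addf x)) f s

/-- the differential of a function, as a linear form on vector fields -/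
def diff (f : M.F) : M.X →ₗ[M.F] M.F where
  toFun x := M.act x f
  map_add' x y := M.act_addv x y f
  map_smul' k x := M.act_smulv k x f

theorem diff_apply (f : M.F) (x : M.X) : diff f x = M.act x f := rfl

end Man

namespace Metric

variable {M : Man} {n : ℕ} (G : Metric M n)

theorem eps_mul_self (i : Fin n) : G.eps i * G.eps i = 1 := by
  rcases G.eps_pm i with h | h <;> simp [h]

theorem act_eps (x : M.X) (i : Fin n) : M.act x (G.eps i) = 0 := by
  rcases G.eps_pm i with h | h <;> simp [h, Man.act_neg, Man.act_one]

/-- the metric pairing with a fixed vector field, as a linear form -/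
def gl (y : M.X) : M.X →ₗ[M.F] M.F where
  toFun x := G.g x y
  map_add' x z := G.g_addl x z y
  map_smul' k x := G.g_smull k x y

theorem gl_apply (x y : M.X) : G.gl y x = G.g x y := rfl

theorem g_subl (x y z : M.X) : G.g (x - y) z = G.g x z - G.g y z := map_sub (G.gl z) x y

theorem g_negl (x z : M.X) : G.g (-x) z = -G.g x z := map_neg (G.gl z) x

theorem g_zerol (z : M.X) : G.g 0 z = 0 := map_zero (G.gl z)

theorem g_addr (x y z : M.X) : G.g x (y + z) = G.g x y + G.g x z := by
  rw [G.g_symm, G.g_addl, G.g_symm y, G.g_symm z]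

theorem g_smulr (f : M.F) (x y : M.X) : G.g x (f • y) = f * G.g x y := by
  rw [G.g_symm, G.g_smull, G.g_symm y]

theorem g_subr (x y z : M.X) : G.g x (y - z) = G.g x y - G.g x z := by
  rw [G.g_symm, G.g_subl, G.g_symm y, G.g_symm z]

theorem linear_expand (f : M.X →ₗ[M.F] M.F) (x : M.X) :
    f x = ∑ i, G.eps i * G.g x (G.e i) * f (G.e i) := by
  conv_lhs => rw [G.frame_complete x, map_sum]
  simp

theorem ext_g {x y : M.X} (h : ∀ z, G.g x z = G.g y z) : x = y := by
  rw [G.frame_complete x, G.frame_complete y]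
  simp [h]

theorem g_grad (f : M.F) (z : M.X) : G.g (G.grad f) z = M.act z f := by
  have h := G.linear_expand (Man.diff f) z
  rw [Man.diff_apply] at h
  rw [h, ← gl_apply, grad, map_sum]
  refine Finset.sum_congr rfl fun i _ => ?_
  rw [map_smul, gl_apply, G.g_symm, Man.diff_apply, smul_eq_mul]
  ring

theorem sum_eps_g : ∑ i, G.eps i * G.g (G.e i) (G.e i) = (n : M.F) := by
  simp [G.frame_on, G.eps_mul_self]

section projector

variable {G} {v : M.X → M.X}

theorem IsProjector.map_sub (hv : G.IsProjector v) (x y : M.X) : v (x - y) = v x - v y :=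
  _root_.map_sub (AddMonoidHom.mk' v hv.2.1) x y

theorem IsProjector.map_zero (hv : G.IsProjector v) : v 0 = 0 :=
  _root_.map_zero (AddMonoidHom.mk' v hv.2.1)

/-- a projector as a linear map -/
def IsProjector.lin (hv : G.IsProjector v) : M.X →ₗ[M.F] M.X where
  toFun := v
  map_add' := hv.2.1
  map_smul' := hv.1

theorem IsProjector.lin_apply (hv : G.IsProjector v) (x : M.X) : hv.lin x = v x := rfl

theorem IsProjector.idem (hv : G.IsProjector v) (x : M.X) : v (v x) = v x := hv.2.2.1 x

theorem IsProjector.selfAdj (hv : G.IsProjector v) (x y : M.X) :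
    G.g (v x) y = G.g x (v y) := hv.2.2.2 x y

theorem IsProjector.co (hv : G.IsProjector v) : G.IsProjector (G.co v) := by
  refine ⟨fun f x => ?_, fun x y => ?_, fun x => ?_, fun x y => ?_⟩
  · simp only [Metric.co, hv.1, smul_sub]
  · simp only [Metric.co, hv.2.1]; abel
  · simp only [Metric.co, hv.map_sub, hv.idem]; abel
  · simp only [Metric.co, G.g_subl, G.g_subr, hv.selfAdj]

theorem ptrace_co : G.ptrace (G.co v) = (n : M.F) - G.ptrace v := by
  simp only [ptrace, co, G.g_subl, mul_sub, Finset.sum_sub_distrib, G.sum_eps_g]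

theorem IsProjector.eq_zero_of_ptrace_eq_zero (hv : G.IsProjector v) (h : G.ptrace v = 0)
    (x : M.X) : v x = 0 := by
  let A : Matrix (Fin n) (Fin n) M.F := Matrix.of fun i j => G.eps i * G.g (v (G.e j)) (G.e i)
  have hA : A * A = A := by
    ext i j
    rw [Matrix.mul_apply]
    simp only [A, Matrix.of_apply]
    have := G.linear_expand (G.gl (G.e i) ∘ₗ hv.lin) (v (G.e j))
    simp only [LinearMap.comp_apply, gl_apply, hv.lin_apply, hv.idem] at this
    rw [this, Finset.mul_sum]
    exact Finset.sum_congr rfl fun k _ => by ring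
  have h0 := eq_zero_of_idempotent_of_trace_eq_zero A hA
    (by simpa [Matrix.trace, A, ptrace] using h)
  have h1 : ∀ j, v (G.e j) = 0 := by
    intro j
    rw [G.frame_complete (v (G.e j))]
    refine Finset.sum_eq_zero fun i _ => ?_
    have : A i j = 0 := by rw [h0, Matrix.zero_apply]
    simp only [A, Matrix.of_apply] at this
    rw [this, zero_smul]
  have h2 : hv.lin x = 0 := by
    rw [G.frame_complete x, map_sum]
    refine Finset.sum_eq_zero fun i _ => ?_
    rw [map_smul, hv.lin_apply, h1, smul_zero]
  exact h2

/-- Contraction of a vanishing symmetrized product `S{v ⊗ ω}` on a distribution. -/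
theorem IsProjector.form_eq_zero (hv : G.IsProjector v) {p : ℕ} (hp : G.ptrace v = (p : M.F))
    (ω : M.X →ₗ[M.F] M.F)
    (h : ∀ x y z, ω (v x) * G.g (v y) (v z) + ω (v y) * G.g (v z) (v x)
      + ω (v z) * G.g (v x) (v y) = 0) (x : M.X) : ω (v x) = 0 := by
  have h1 : ∑ i, G.eps i * G.g (v (G.e i)) (v (G.e i)) = (p : M.F) := by
    rw [← hp, ptrace]
    exact Finset.sum_congr rfl fun i _ => by rw [← hv.selfAdj, hv.idem]
  have h2 : ∑ i, G.eps i * G.g (v x) (v (G.e i)) * ω (v (G.e i)) = ω (v x) := by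
    have := G.linear_expand (ω ∘ₗ hv.lin) (v x)
    simp only [LinearMap.comp_apply, hv.lin_apply, hv.idem] at this
    rw [this]
    exact Finset.sum_congr rfl fun i _ => by rw [← hv.selfAdj, hv.idem]
  have h3 : ((p + 2 : ℕ) : M.F) * ω (v x) = 0 := by
    calc ((p + 2 : ℕ) : M.F) * ω (v x)
        = ω (v x) * ∑ i, G.eps i * G.g (v (G.e i)) (v (G.e i))
          + 2 * ∑ i, G.eps i * G.g (v x) (v (G.e i)) * ω (v (G.e i)) := by
          rw [h1, h2]; push_cast; ring
      _ = ∑ i, G.eps i * (ω (v x) * G.g (v (G.e i)) (v (G.e i))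
          + ω (v (G.e i)) * G.g (v (G.e i)) (v x) + ω (v (G.e i)) * G.g (v x) (v (G.e i))) := by
          rw [Finset.mul_sum, Finset.mul_sum, ← Finset.sum_add_distrib]
          refine Finset.sum_congr rfl fun i _ => ?_
          rw [G.g_symm (v (G.e i)) (v x)]
          ring
      _ = 0 := by simp [h]
  exact ((Man.isUnit_natCast (p + 2) (by omega)).mul_right_eq_zero).1 h3

/-- The vector `a` in `S_v = ½ v ⊗ a` is orthogonal to a distribution of positive dimension. -/
theorem IsProjector.apply_umbilical_eq_zero (hv : G.IsProjector v) {p : ℕ}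
    (hp : G.ptrace v = (p : M.F)) (hp0 : p ≠ 0) {a : M.X} (ha : G.UmbilicalWith v a) :
    v a = 0 := by
  have h1 : ∀ x y, G.g (v x) (v y) • v a = 0 := by
    intro x y
    rw [← hv.1, ← ha x y]
    simp only [Qv, Metric.co, hv.2.1, hv.map_sub, hv.idem, sub_self, add_zero]
  have h2 : (p : M.F) • v a = 0 := by
    rw [← hp, ptrace, Finset.sum_smul]
    refine Finset.sum_eq_zero fun i _ => ?_
    rw [mul_smul, ← hv.idem (G.e i), hv.selfAdj, h1, smul_zero]
  exact ((Man.isUnit_natCast p hp0).smul_eq_zero).1 h2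

end projector

theorem nabla2_addr {T : M.X → M.X → M.F} (hT : G.Bilin T) (x y z w : M.X) :
    G.nabla2 T x y (z + w) = G.nabla2 T x y z + G.nabla2 T x y w := by
  simp only [nabla2, hT.2.2.2, M.act_addf, G.conn_addr]; ring

theorem nabla2_smulr {T : M.X → M.X → M.F} (hT : G.Bilin T) (f : M.F) (x y z : M.X) :
    G.nabla2 T x y (f • z) = f * G.nabla2 T x y z := by
  simp only [nabla2, hT.2.2.2, hT.2.2.1, M.act_mulf, G.conn_leibniz]; ring

/-- the canonical 1-form of the conformal equation, as a linear form -/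
def ctl {T : M.X → M.X → M.F} (hT : G.Bilin T) : M.X →ₗ[M.F] M.F where
  toFun := G.ct T
  map_add' z w := by
    simp only [ct, div2, G.nabla2_addr hT, mul_add, Finset.sum_add_distrib]
  map_smul' f z := by
    simp only [ct, div2, G.nabla2_smulr hT, Finset.mul_sum, RingHom.id_apply, smul_eq_mul]
    exact Finset.sum_congr rfl fun i _ => by ring

theorem sum_eps_conn {T : M.X → M.X → M.F} (hT : G.Bilin T) (hs : G.Symm2 T) (z : M.X) :
    ∑ i, G.eps i * T (G.conn z (G.e i)) (G.e i) = 0 := by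
  have h1 : ∀ i, T (G.conn z (G.e i)) (G.e i)
      = ∑ j, G.eps j * G.g (G.conn z (G.e i)) (G.e j) * T (G.e j) (G.e i) := fun i =>
    G.linear_expand { toFun := fun x => T x (G.e i), map_add' := fun x y => hT.2.1 x y _,
                      map_smul' := fun f x => hT.1 f x _ } _
  have h2 : ∀ i j, G.g (G.conn z (G.e i)) (G.e j) = -G.g (G.conn z (G.e j)) (G.e i) := by
    intro i j
    have h := G.metric_compat z (G.e i) (G.e j)
    rw [G.g_symm (G.e i) (G.conn z (G.e j))] at h
    have h0 : M.act z (G.g (G.e i) (G.e j)) = 0 := by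
      rw [G.frame_on]; split_ifs
      · exact G.act_eps z i
      · exact Man.act_zero z
    linear_combination h0 - h
  set S := ∑ i, G.eps i * T (G.conn z (G.e i)) (G.e i) with hS
  have h3 : S = -S := by
    have e1 : S = ∑ i, ∑ j, G.eps i * (G.eps j * G.g (G.conn z (G.e i)) (G.e j)
        * T (G.e j) (G.e i)) := by
      simp only [hS, h1, Finset.mul_sum]
    conv_rhs => rw [e1, Finset.sum_comm]
    rw [e1, ← Finset.sum_neg_distrib]
    refine Finset.sum_congr rfl fun i _ => ?_
    rw [← Finset.sum_neg_distrib]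
    refine Finset.sum_congr rfl fun j _ => ?_
    rw [h2 i j, hs (G.e j) (G.e i)]
    ring
  have h4 : ((2 : ℕ) : M.F) * S = 0 := by push_cast; linear_combination h3
  exact ((Man.isUnit_natCast 2 (by norm_num)).mul_right_eq_zero).1 h4

/-- For a traceless tensor, the 1-form in the conformal equation is the canonical one. -/
theorem IsConformalWith.ct_eq {T : M.X → M.X → M.F} {t : M.X →ₗ[M.F] M.F}
    (h : G.IsConformalWith T t) (htr : G.tr2 T = 0) : G.ct T = t := by
  obtain ⟨hT, hs, hk⟩ := h
  funext z
  have e1 : ∑ i, G.eps i * G.nabla2 T z (G.e i) (G.e i) = 0 := by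
    have e2 : ∑ i, G.eps i * M.act z (T (G.e i) (G.e i)) = 0 := by
      have := congrArg (M.act z) htr
      rw [tr2, Man.act_sum, Man.act_zero] at this
      simpa [M.act_mulf, G.act_eps] using this
    have e3 := G.sum_eps_conn hT hs z
    have : ∑ i, G.eps i * G.nabla2 T z (G.e i) (G.e i)
        = ∑ i, G.eps i * M.act z (T (G.e i) (G.e i))
          - 2 * ∑ i, G.eps i * T (G.conn z (G.e i)) (G.e i) := by
      rw [Finset.mul_sum, ← Finset.sum_sub_distrib]
      refine Finset.sum_congr rfl fun i _ => ?_
      rw [nabla2, hs (G.e i) (G.conn z (G.e i))]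
      ring
    rw [this, e2, e3]; ring
  have e4 : ∑ i, G.eps i * G.killingOp T (G.e i) (G.e i) z = 2 * G.div2 T z := by
    have : ∑ i, G.eps i * G.killingOp T (G.e i) (G.e i) z
        = 2 * G.div2 T z + ∑ i, G.eps i * G.nabla2 T z (G.e i) (G.e i) := by
      rw [div2, Finset.mul_sum, ← Finset.sum_add_distrib]
      refine Finset.sum_congr rfl fun i _ => ?_
      have : G.nabla2 T (G.e i) z (G.e i) = G.nabla2 T (G.e i) (G.e i) z := by
        simp only [nabla2]
        rw [hs z, hs (G.conn _ z), hs z]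
        ring
      rw [killingOp, this]
      ring
    rw [this, e1, add_zero]
  have e5 : ∑ i, G.eps i * G.symG t (G.e i) (G.e i) z = ((n : M.F) + 2) * t z := by
    have := G.linear_expand t z
    calc ∑ i, G.eps i * G.symG t (G.e i) (G.e i) z
        = (∑ i, G.eps i * G.g (G.e i) (G.e i)) * t z
          + 2 * ∑ i, G.eps i * G.g z (G.e i) * t (G.e i) := by
          rw [Finset.mul_sum, Finset.sum_mul, ← Finset.sum_add_distrib]
          refine Finset.sum_congr rfl fun i _ => ?_
          rw [symG, G.g_symm (G.e i) z]
          ring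
      _ = _ := by rw [← this, G.sum_eps_g]; ring
  have e6 : 2 * G.div2 T z = ((n : M.F) + 2) * t z := by
    rw [← e4, ← e5]
    exact Finset.sum_congr rfl fun i _ => by rw [hk]
  have e7 : algebraMap ℝ M.F (2 / ((n : ℝ) + 2)) = 2 * algebraMap ℝ M.F (1 / ((n : ℝ) + 2)) := by
    rw [← map_ofNat (algebraMap ℝ M.F) 2, ← map_mul]
    congr 1; ring
  have e8 : algebraMap ℝ M.F (1 / ((n : ℝ) + 2)) * ((n : M.F) + 2) = 1 := by
    rw [← map_ofNat (algebraMap ℝ M.F) 2, ← map_natCast (algebraMap ℝ M.F) n, ← map_add,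
      ← map_mul, one_div_mul_cancel (by positivity), map_one]
  rw [ct, e7]
  linear_combination algebraMap ℝ M.F (1 / ((n : ℝ) + 2)) * e6 + t z * e8

theorem isConformal_zero : G.IsConformal (fun _ _ => 0) := by
  refine ⟨⟨by simp, by simp, by simp, by simp⟩, fun _ _ => rfl, fun x y z => ?_⟩
  simp [killingOp, symG, ct, div2, nabla2, Man.act_zero]

section almostProduct

variable {G} {v : M.X → M.X}

/-- the traceless tensor `α (q v - p h)` of an almost-product structure -/
abbrev tracelessTensor (G : Metric M n) (v : M.X → M.X) (p q : ℕ) (α : M.F) (x y : M.X) : M.F :=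
  α * ((q : M.F) * G.g (v x) y - (p : M.F) * G.g (x - v x) y)

theorem IsProjector.bilin_tracelessTensor (hv : G.IsProjector v) (p q : ℕ) (α : M.F) :
    G.Bilin (G.tracelessTensor v p q α) := by
  refine ⟨?_, ?_, ?_, ?_⟩ <;> intros <;>
    simp only [tracelessTensor, hv.1, hv.2.1, G.g_addl, G.g_addr, G.g_smull, G.g_smulr,
      G.g_subl] <;> ring

theorem IsProjector.symm_tracelessTensor (hv : G.IsProjector v) (p q : ℕ) (α : M.F) :
    G.Symm2 (G.tracelessTensor v p q α) := by
  intro x y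
  simp only [tracelessTensor, G.g_subl, hv.selfAdj x y, G.g_symm x]

theorem nabla2_tracelessTensor (hv : G.IsProjector v) (p q : ℕ) (α : M.F) (x y z : M.X) :
    G.nabla2 (G.tracelessTensor v p q α) x y z
      = M.act x α * ((q : M.F) * G.g (v y) z - (p : M.F) * G.g (y - v y) z)
        + ((p : M.F) + q) * α * (G.g (G.conn x (v y)) (z - v z)
          + G.g (G.conn x (v z)) (y - v y)) := by
  have h1 := G.metric_compat x (v y) (v z)
  have h2 := G.metric_compat x y (v z)
  have h3 : G.g (v y) (v z) = G.g y (v z) := by rw [hv.selfAdj, hv.idem]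
  rw [h3] at h1
  simp only [nabla2, tracelessTensor, G.g_subl, G.g_subr, M.act_mulf, Man.act_sub,
    Man.act_natCast, G.metric_compat]
  rw [hv.selfAdj (G.conn x y) z, G.g_symm (G.conn x (v z)) (v y),
    G.g_symm (G.conn x (v z)) y]
  linear_combination ((p : M.F) + q) * α * (h2 - h1)

theorem g_conn_eq (hv : G.IsProjector v) (x y z : M.X) :
    G.g (G.conn x (v y)) (z - v z)
      = G.g (G.Qv v x y) z - G.g (G.Qv (G.co v) x z) y := by
  have h1 : G.conn x (v y) = G.conn (v x) (v y) + G.conn (x - v x) (v y) := by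
    rw [← G.conn_addl]; congr 1; abel
  have h2 := G.metric_compat (x - v x) (v y) (z - v z)
  have h3 : G.g (v y) (z - v z) = 0 := by
    rw [hv.selfAdj, hv.map_sub, hv.idem, sub_self, G.g_symm, G.g_zerol]
  rw [h3, Man.act_zero] at h2
  have h4 : G.g (G.Qv v x y) z = G.g (G.conn (v x) (v y)) (z - v z) := by
    simp only [Qv, co, G.g_subl, G.g_subr, hv.selfAdj]
  have h5 : G.g (G.Qv (G.co v) x z) y = G.g (v y) (G.conn (x - v x) (z - v z)) := by
    simp only [Qv, co, sub_sub_cancel]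
    rw [hv.selfAdj, G.g_symm]
  rw [h1, G.g_addl, h4, h5]
  linear_combination -h2

theorem killingOp_tracelessTensor (hv : G.IsProjector v) (p q : ℕ) (α : M.F) (x y z : M.X) :
    G.killingOp (G.tracelessTensor v p q α) x y z
      = M.act x α * ((q : M.F) * G.g (v y) (v z) - (p : M.F) * G.g (G.co v y) (G.co v z))
        + M.act y α * ((q : M.F) * G.g (v z) (v x) - (p : M.F) * G.g (G.co v z) (G.co v x))
        + M.act z α * ((q : M.F) * G.g (v x) (v y) - (p : M.F) * G.g (G.co v x) (G.co v y))
        + ((p : M.F) + q) * α *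
          (G.g (G.Qv v x y + G.Qv v y x) z + G.g (G.Qv v y z + G.Qv v z y) x
            + G.g (G.Qv v z x + G.Qv v x z) y
            - G.g (G.Qv (G.co v) x y + G.Qv (G.co v) y x) z
            - G.g (G.Qv (G.co v) y z + G.Qv (G.co v) z y) x
            - G.g (G.Qv (G.co v) z x + G.Qv (G.co v) x z) y) := by
  have e1 : ∀ x y, G.g (v x) (v y) = G.g (v x) y := fun x y => by
    rw [← hv.selfAdj, hv.idem]
  have e2 : ∀ x y, G.g (G.co v x) (G.co v y) = G.g (x - v x) y := fun x y => by
    rw [← hv.co.selfAdj, hv.co.idem, co]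
  simp only [killingOp, nabla2_tracelessTensor hv, g_conn_eq hv, G.g_addl, e1, e2]
  ring

theorem IsProjector.co_apply_self (hv : G.IsProjector v) (x : M.X) : G.co v (v x) = 0 := by
  rw [Metric.co, hv.idem, sub_self]

theorem IsProjector.apply_co_self (hv : G.IsProjector v) (x : M.X) : v (G.co v x) = 0 := by
  rw [Metric.co, hv.map_sub, hv.idem, sub_self]

theorem conn_zero_right (x : M.X) : G.conn x 0 = 0 :=
  _root_.map_zero (AddMonoidHom.mk' (G.conn x) (G.conn_addr x))

theorem conn_zero_left (x : M.X) : G.conn 0 x = 0 :=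
  map_zero (AddMonoidHom.mk' (fun y => G.conn y x) fun y z => G.conn_addl y z x)

theorem co_co (x : M.X) : G.co (G.co v) x = v x := by
  simp only [co, sub_sub_cancel]

theorem co_add_apply (x : M.X) : v x + G.co v x = x := by
  simp only [co, add_sub_cancel]

theorem g_zeror (x : M.X) : G.g x 0 = 0 := by
  rw [G.g_symm, G.g_zerol]

theorem IsProjector.g_co_apply (hv : G.IsProjector v) (x y : M.X) :
    G.g (G.co v x) (v y) = 0 := by
  rw [← hv.selfAdj, hv.apply_co_self, G.g_zerol]

theorem IsProjector.g_apply_co (hv : G.IsProjector v) (x y : M.X) :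
    G.g (v x) (G.co v y) = 0 := by
  rw [G.g_symm, hv.g_co_apply]

theorem IsProjector.umbilicalWith_of_conformal (hv : G.IsProjector v) {p q : ℕ} {α : M.F}
    (hpq : p + q ≠ 0) (hα : IsUnit α) {t : M.X → M.F}
    (hk : ∀ x y z, G.killingOp (G.tracelessTensor v p q α) x y z = G.symG t x y z)
    (ht : ∀ x, t (G.co v x) = -((p : M.F) * M.act (G.co v x) α)) :
    G.UmbilicalWith v (-(Ring.inverse α • G.co v (G.grad α))) := by
  intro x y
  refine G.ext_g fun z => ?_
  have h := hk (v x) (v y) (G.co v z)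
  rw [killingOp_tracelessTensor hv] at h
  simp only [symG, Qv, co_co, hv.idem, hv.co.idem, hv.co_apply_self, hv.apply_co_self,
    hv.g_co_apply, hv.g_apply_co, conn_zero_left, conn_zero_right, hv.map_zero, hv.co.map_zero,
    G.g_zerol, g_zeror, G.g_addl, ht] at h
  have hu : Ring.inverse α * α = 1 := Ring.inverse_mul_cancel α hα
  have e1 : ∀ w, G.g (G.co v w) (G.co v z) = G.g (G.co v w) z := fun w => by
    rw [← hv.co.selfAdj, hv.co.idem]
  simp only [e1] at h
  rw [G.g_smull, G.g_negl, G.g_smull, hv.co.selfAdj, G.g_grad, G.g_addl]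
  have hn := Man.isUnit_natCast (M := M) (p + q) hpq
  refine hn.mul_left_cancel ?_
  push_cast
  simp only [Qv]
  linear_combination Ring.inverse α * h - ((p : M.F) + q) *
    (G.g (G.co v (G.conn (v x) (v y))) z + G.g (G.co v (G.conn (v y) (v x))) z) * hu

theorem IsProjector.canonical_form_apply (hv : G.IsProjector v) {p q : ℕ} {α : M.F}
    (hp : G.ptrace v = (p : M.F)) {t : M.X →ₗ[M.F] M.F}
    (hk : ∀ x y z, G.killingOp (G.tracelessTensor v p q α) x y z = G.symG t x y z) (x : M.X) :
    t (v x) = (q : M.F) * M.act (v x) α := by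
  have h0 := hv.form_eq_zero hp (t - (q : M.F) • Man.diff α) (fun x y z => by
    have h := hk (v x) (v y) (v z)
    rw [killingOp_tracelessTensor hv] at h
    simp only [symG, Qv, co_co, hv.idem, hv.co_apply_self,
      hv.g_co_apply, conn_zero_right, hv.map_zero, G.g_zerol, G.g_addl] at h
    simp only [LinearMap.sub_apply, LinearMap.smul_apply, Man.diff_apply, smul_eq_mul]
    linear_combination -h) x
  simp only [LinearMap.sub_apply, LinearMap.smul_apply, Man.diff_apply, smul_eq_mul] at h0
  linear_combination h0

theorem tracelessTensor_co (p q : ℕ) (α : M.F) :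
    G.tracelessTensor (G.co v) q p (-α) = G.tracelessTensor v p q α := by
  funext x y
  simp only [tracelessTensor, co, sub_sub_cancel]
  ring

theorem tr2_tracelessTensor {p q : ℕ} (hpq : p + q = n) (hp : G.ptrace v = (p : M.F))
    (α : M.F) : G.tr2 (G.tracelessTensor v p q α) = 0 := by
  have h1 : G.ptrace (G.co v) = (q : M.F) := by
    rw [ptrace_co, hp, ← hpq]; push_cast; ring
  have h2 : G.tr2 (G.tracelessTensor v p q α)
      = α * ((q : M.F) * G.ptrace v - (p : M.F) * G.ptrace (G.co v)) := by
    simp only [tr2, ptrace, tracelessTensor, co, Finset.mul_sum, ← Finset.sum_sub_distrib]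
    exact Finset.sum_congr rfl fun i _ => by ring
  rw [h2, hp, h1]; ring

theorem IsProjector.isConformal_of_umbilicalWith (hv : G.IsProjector v) {p q : ℕ}
    (hpq : p + q = n) (hp : G.ptrace v = (p : M.F)) {α : M.F} (hα : IsUnit α) {a b : M.X}
    (hva : v a = 0) (hhb : G.co v b = 0) (ha : G.UmbilicalWith v a)
    (hb : G.UmbilicalWith (G.co v) b) (hab : a + b = -(Ring.inverse α • G.grad α)) :
    G.IsConformal (G.tracelessTensor v p q α) := by
  have hu : α * Ring.inverse α = 1 := Ring.mul_inverse_cancel α hα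
  have hsum : ∀ z, α * G.g (a + b) z = -M.act z α := fun z => by
    rw [hab, G.g_negl, G.g_smull, G.g_grad]
    linear_combination -(M.act z α) * hu
  have ea : ∀ z, α * G.g a z = -M.act (G.co v z) α := fun z => by
    have h := hsum (G.co v z)
    rwa [← hv.co.selfAdj, hv.co.2.1, hhb, add_zero, Metric.co, hva, sub_zero] at h
  have eb : ∀ z, α * G.g b z = -M.act (v z) α := fun z => by
    have h := hsum (v z)
    have hvb := co_add_apply (G := G) (v := v) b
    rw [hhb, add_zero] at hvb
    rwa [← hv.selfAdj, hv.2.1, hva, zero_add, hvb] at h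
  have edec : ∀ z, M.act z α = M.act (v z) α + M.act (G.co v z) α := fun z => by
    rw [← M.act_addv, co_add_apply]
  have eg : ∀ x y, G.g x y = G.g (v x) (v y) + G.g (G.co v x) (G.co v y) := fun x y => by
    rw [← hv.selfAdj, ← hv.co.selfAdj, hv.idem, hv.co.idem, ← G.g_addl, co_add_apply]
  let t : M.X →ₗ[M.F] M.F :=
    (q : M.F) • (Man.diff α ∘ₗ hv.lin) - (p : M.F) • (Man.diff α ∘ₗ hv.co.lin)
  have ht : ∀ z, t z = (q : M.F) * M.act (v z) α - (p : M.F) * M.act (G.co v z) α :=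
    fun z => rfl
  have hc : G.IsConformalWith (G.tracelessTensor v p q α) t := by
    refine ⟨hv.bilin_tracelessTensor p q α, hv.symm_tracelessTensor p q α, fun x y z => ?_⟩
    rw [killingOp_tracelessTensor hv]
    simp only [ha _ _, hb _ _, symG, ht, G.g_smull, eg x y, eg y z, eg z x, edec x, edec y,
      edec z]
    linear_combination ((p : M.F) + q) *
      (G.g (v x) (v y) * ea z + G.g (v y) (v z) * ea x + G.g (v z) (v x) * ea y
        - G.g (G.co v x) (G.co v y) * eb z - G.g (G.co v y) (G.co v z) * eb x
        - G.g (G.co v z) (G.co v x) * eb y)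
  rw [IsConformal, hc.ct_eq G (tr2_tracelessTensor hpq hp α)]
  exact hc

end almostProduct

end Metric

/-- Proposition 3: `P = α (q v - p h)` is a conformal tensor iff the
eigenstructure is umbilical and `a + b = - d ln |α|`. -/
theorem stmt_9 {M : Man} {n : ℕ} (G : Metric M n) (p q : ℕ) (hpq : p + q = n)
    (v : M.X → M.X) (hv : G.IsProjector v) (hd : G.ptrace v = (p : M.F))
    (α : M.F) (ha : IsUnit α) :
    G.IsConformal (fun x y =>
        α * ((q : M.F) * G.g (v x) y - (p : M.F) * G.g (x - v x) y)) ↔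
      ∃ a b : M.X, G.UmbilicalWith v a ∧ G.UmbilicalWith (G.co v) b ∧
        a + b = -(Ring.inverse α • G.grad α) := by
  have hq : G.ptrace (G.co v) = (q : M.F) := by
    rw [Metric.ptrace_co, hd, ← hpq]; push_cast; ring
  constructor
  · rintro ⟨hT, -, hk⟩
    rcases eq_or_ne (p + q) 0 with h0 | h0
    · have hX : ∀ x : M.X, x = 0 := fun x => by
        obtain rfl : n = 0 := by omega
        rw [G.frame_complete x, Fin.sum_univ_zero]
      exact ⟨0, 0, fun _ _ => by rw [hX (_ + _), hX (_ • _)],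
        fun _ _ => by rw [hX (_ + _), hX (_ • _)], by rw [hX (_ + _), hX (-_)]⟩
    have hk1 : ∀ x y z, G.killingOp (G.tracelessTensor v p q α) x y z
        = G.symG (G.ctl hT) x y z := hk
    have hk2 : ∀ x y z, G.killingOp (G.tracelessTensor (G.co v) q p (-α)) x y z
        = G.symG (G.ctl hT) x y z := by
      rw [Metric.tracelessTensor_co]; exact hk
    refine ⟨_, _, hv.umbilicalWith_of_conformal h0 ha hk1 fun x => ?_,
      hv.co.umbilicalWith_of_conformal (by omega) ha.neg hk2 fun x => ?_, ?_⟩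
    · rw [hv.co.canonical_form_apply hq hk2, Man.act_neg, mul_neg]
    · rw [Metric.co_co, hv.canonical_form_apply hd hk1, Man.act_neg, mul_neg, neg_neg]
    · refine G.ext_g fun z => ?_
      have hinv : Ring.inverse (-α) = -Ring.inverse α := by
        obtain ⟨u, rfl⟩ := ha
        rw [← Units.val_neg, Ring.inverse_unit, Ring.inverse_unit, inv_neg, Units.val_neg]
      have hz : M.act z α = M.act (v z) α + M.act (G.co v z) α := by
        rw [← M.act_addv, Metric.co_add_apply]
      simp only [G.g_addl, G.g_negl, G.g_smull, Metric.co_co, hv.selfAdj, hv.co.selfAdj,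
        G.g_grad, Man.act_neg, hinv, hz]
      ring
  · rintro ⟨a, b, hua, hub, hab⟩
    rcases eq_or_ne p 0 with rfl | hp0
    · have hv0 := hv.eq_zero_of_ptrace_eq_zero (by simpa using hd)
      simpa [hv0, G.g_zerol] using G.isConformal_zero
    rcases eq_or_ne q 0 with rfl | hq0
    · have hh0 : ∀ x, x - v x = 0 := hv.co.eq_zero_of_ptrace_eq_zero (by simpa using hq)
      simpa [hh0, G.g_zerol] using G.isConformal_zero
    exact hv.isConformal_of_umbilicalWith hpq hd ha
      (hv.apply_umbilical_eq_zero hd hp0 hua) (hv.co.apply_umbilical_eq_zero hq hq0 hub)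
      hua hub hab

end KCT
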